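/- The Gaussian-type Riemann sum estimate: for a symmetric complex n×n matrix Ω with positive definite imaginary part, and any shift vector w ∈ ℝⁿ (or ℂⁿ with bounded imaginary part), the sum k^{-n/2} Σ_{l ∈ (1/√k)ℤⁿ + w} exp(πi ᵗl Ω l) converges, as k → ∞, to the Gaussian integral ∫_{ℝⁿ} exp(πi ᵗl Ω l) dl, with error O(1/√k) uniformly in w. -/

import Mathlib

open Real MeasureTheory

/-- The sum of an integrable function over the integer lattice differs from its integral by at
most the integral of any bound for its oscillation on the unit cubes. -/
theorem norm_tsum_sub_integral_le_integral {ι : Type*} [Fintype ι] {F : (ι → ℝ) → ℂ}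
    {G : (ι → ℝ) → ℝ} (hFm : Measurable F) (hF : Integrable F) (hG : Integrable G)
    (h : ∀ y, ‖F (fun i => (⌊y i⌋ : ℝ)) - F y‖ ≤ G y) :
    ‖∑' l : ι → ℤ, F (fun i => (l i : ℝ)) - ∫ y, F y‖ ≤ ∫ y, G y := by
  have hfloor : Measurable fun y : ι → ℝ => F (fun i => (⌊y i⌋ : ℝ)) := by
    refine hFm.comp (measurable_pi_lambda _ fun i => ?_)
    exact (measurable_from_top (f := fun m : ℤ => (m : ℝ))).comp
      (Int.measurable_floor.comp (measurable_pi_apply i))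
  have hfloor_int : Integrable fun y : ι → ℝ => F (fun i => (⌊y i⌋ : ℝ)) := by
    refine (hF.norm.add hG).mono' hfloor.aestronglyMeasurable (ae_of_all _ fun y => ?_)
    have h₁ := h y
    have h₂ := norm_le_norm_add_norm_sub' (F fun i => (⌊y i⌋ : ℝ)) (F y)
    simp only [Pi.add_apply]
    linarith
  let s : (ι → ℤ) → Set (ι → ℝ) := fun l =>
    Set.univ.pi fun i => Set.Ico (l i : ℝ) (l i + 1)
  have hmem : ∀ l y, y ∈ s l ↔ ∀ i, ⌊y i⌋ = l i := fun l y => by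
    simp [s, Set.mem_pi, Int.floor_eq_iff]
  have hs : ∀ l, MeasurableSet (s l) := fun l =>
    MeasurableSet.univ_pi fun i => measurableSet_Ico
  have hdisj : Pairwise (Function.onFun Disjoint s) := fun l m hlm => by
    refine Set.disjoint_left.2 fun y hl hm => hlm (funext fun i => ?_)
    rw [← (hmem l y).1 hl i, (hmem m y).1 hm i]
  have hunion : ⋃ l, s l = Set.univ :=
    Set.eq_univ_of_forall fun y =>
      Set.mem_iUnion.2 ⟨fun i => ⌊y i⌋, (hmem _ y).2 fun _ => rfl⟩
  have hsum := hasSum_integral_iUnion hs hdisj hfloor_int.integrableOn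
  have hcube : ∀ l : ι → ℤ,
      ∫ y in s l, F (fun i => (⌊y i⌋ : ℝ)) = F (fun i => (l i : ℝ)) := fun l => by
    have hvol : volume.real (s l) = 1 := by
      simp [s, Measure.real, Real.volume_pi_Ico]
    rw [setIntegral_congr_fun (g := fun _ => F (fun i => (l i : ℝ))) (hs l)
      (fun y hy => by simp only [(hmem l y).1 hy]), setIntegral_const, hvol, one_smul]
  rw [hunion, setIntegral_univ] at hsum
  simp only [hcube] at hsum
  rw [hsum.tsum_eq, ← integral_sub hfloor_int hF]
  exact norm_integral_le_of_norm_le hG (ae_of_all _ h)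

theorem norm_cexp_sub_cexp_le {a b : ℂ} {M : ℝ} (ha : a.re ≤ M) (hb : b.re ≤ M) :
    ‖Complex.exp a - Complex.exp b‖ ≤ Real.exp M * ‖a - b‖ :=
  Convex.norm_image_sub_le_of_norm_deriv_le (s := {c : ℂ | c.re ≤ M})
    (fun _ _ => Complex.differentiableAt_exp)
    (fun z hz => by
      rw [Complex.deriv_exp, Complex.norm_exp]
      exact Real.exp_le_exp.2 hz)
    (convex_halfSpace_re_le M) hb ha

theorem integrable_exp_neg_mul_sq_norm_pi {ι : Type*} [Fintype ι] {b : ℝ} (hb : 0 < b) :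
    Integrable fun x : ι → ℝ => Real.exp (-b * ‖x‖ ^ 2) := by
  set b' : ℝ := b / (Fintype.card ι + 1) with hb'
  have hb'pos : 0 < b' := by positivity
  have h := (GaussianFourier.integrable_cexp_neg_mul_sum_add (b := (b' : ℂ)) (ι := ι)
    (by simpa using hb'pos) 0).norm
  refine h.mono' (by fun_prop) (ae_of_all _ fun x => ?_)
  rw [Real.norm_eq_abs, Real.abs_exp, Complex.norm_exp]
  have hre : (-(b' : ℂ) * ∑ i, (x i : ℂ) ^ 2 + ∑ i, (0 : ι → ℂ) i * (x i : ℂ)).re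
      = -b' * ∑ i, x i ^ 2 := by
    simp only [Pi.zero_apply, zero_mul, Finset.sum_const_zero, add_zero]
    rw [← Complex.ofReal_re (-b' * ∑ i, x i ^ 2)]
    push_cast
    rfl
  rw [hre]
  refine Real.exp_le_exp.2 ?_
  have hsum : ∑ i, x i ^ 2 ≤ Fintype.card ι * ‖x‖ ^ 2 := by
    have : ∀ i ∈ Finset.univ, x i ^ 2 ≤ ‖x‖ ^ 2 := fun i _ => by
      rw [← sq_abs]
      exact pow_le_pow_left₀ (abs_nonneg _) (norm_le_pi_norm x i) 2
    simpa using Finset.sum_le_sum this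
  have hbb : b = b' * (Fintype.card ι + 1) := by rw [hb']; field_simp
  rw [hbb]
  nlinarith [mul_le_mul_of_nonneg_left hsum hb'pos.le, mul_nonneg hb'pos.le (sq_nonneg ‖x‖)]

theorem Matrix.PosDef.exists_mul_sq_norm_le {ι : Type*} [Fintype ι] {A : Matrix ι ι ℝ}
    (hA : A.PosDef) : ∃ c > 0, ∀ x : ι → ℝ, c * ‖x‖ ^ 2 ≤ ∑ i, ∑ j, x i * A i j * x j := by
  have hpos : ∀ x : ι → ℝ, x ≠ 0 → 0 < ∑ i, ∑ j, x i * A i j * x j := fun x hx => by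
    have := hA.dotProduct_mulVec_pos hx
    simpa [dotProduct, Matrix.mulVec, Finset.mul_sum, mul_assoc] using this
  obtain hempty | hne := (Metric.sphere (0 : ι → ℝ) 1).eq_empty_or_nonempty
  · refine ⟨1, one_pos, fun x => ?_⟩
    have hx : x = 0 := by
      by_contra hx
      have : ‖x‖⁻¹ • x ∈ Metric.sphere (0 : ι → ℝ) 1 := by
        simp [norm_smul, inv_mul_cancel₀ (norm_ne_zero_iff.2 hx)]
      simp [hempty] at this
    simp [hx]
  · obtain ⟨u, hu, hmin⟩ := (isCompact_sphere (0 : ι → ℝ) 1).exists_isMinOn hne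
      (f := fun x : ι → ℝ => ∑ i, ∑ j, x i * A i j * x j) (by fun_prop)
    refine ⟨_, hpos u (ne_zero_of_mem_unit_sphere ⟨u, hu⟩), fun x => ?_⟩
    obtain rfl | hx := eq_or_ne x 0
    · simp
    have hxn : ‖x‖ ≠ 0 := norm_ne_zero_iff.2 hx
    have hv : ‖x‖⁻¹ • x ∈ Metric.sphere (0 : ι → ℝ) 1 := by
      simp [norm_smul, inv_mul_cancel₀ hxn]
    have hle := mul_le_mul_of_nonneg_right (isMinOn_iff.1 hmin _ hv) (sq_nonneg ‖x‖)
    refine hle.trans_eq ?_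
    simp only [Finset.sum_mul, Pi.smul_apply, smul_eq_mul]
    refine Finset.sum_congr rfl fun i _ => Finset.sum_congr rfl fun j _ => ?_
    field_simp

theorem norm_quadratic_sub_le {ι : Type*} [Fintype ι] (Ω : Matrix ι ι ℂ) (x z : ι → ℝ) :
    ‖(∑ i, ∑ j, (z i : ℂ) * Ω i j * (z j : ℂ)) - ∑ i, ∑ j, (x i : ℂ) * Ω i j * (x j : ℂ)‖ ≤
      (∑ i, ∑ j, ‖Ω i j‖) * (‖z - x‖ * (‖z‖ + ‖x‖)) := by
  simp only [← Finset.sum_sub_distrib, Finset.sum_mul]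
  refine norm_sum_le_of_le _ fun i _ => norm_sum_le_of_le _ fun j _ => ?_
  have hsplit : (z i : ℂ) * Ω i j * (z j : ℂ) - (x i : ℂ) * Ω i j * (x j : ℂ) =
      Ω i j * ((z i * (z - x) j + (z - x) i * x j : ℝ) : ℂ) := by
    simp only [Pi.sub_apply]
    push_cast
    ring
  rw [hsplit, norm_mul, Complex.norm_real]
  refine mul_le_mul_of_nonneg_left ?_ (norm_nonneg _)
  refine (norm_add_le _ _).trans ?_
  rw [norm_mul, norm_mul]
  have h₁ := mul_le_mul (norm_le_pi_norm z i) (norm_le_pi_norm (z - x) j) (norm_nonneg _)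
    (norm_nonneg _)
  have h₂ := mul_le_mul (norm_le_pi_norm (z - x) i) (norm_le_pi_norm x j) (norm_nonneg _)
    (norm_nonneg _)
  linarith

theorem re_pi_mul_I_mul_quadratic {ι : Type*} [Fintype ι] (Ω : Matrix ι ι ℂ) (x : ι → ℝ) :
    ((π : ℂ) * Complex.I * ∑ i, ∑ j, (x i : ℂ) * Ω i j * (x j : ℂ)).re =
      -π * ∑ i, ∑ j, x i * (Ω i j).im * x j := by
  have him : (∑ i, ∑ j, (x i : ℂ) * Ω i j * (x j : ℂ)).im =
      ∑ i, ∑ j, x i * (Ω i j).im * x j := by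
    simp [Complex.im_sum]
  rw [mul_assoc, Complex.re_ofReal_mul, Complex.I_mul_re, him]
  ring

/-- A Gaussian with positive definite decay is Lipschitz at unit scale, with a local Lipschitz
constant that itself decays like a Gaussian. -/
theorem exists_norm_gaussian_sub_le {ι : Type*} [Fintype ι] {Ω : Matrix ι ι ℂ}
    (hpos : (Matrix.of fun i j => (Ω i j).im).PosDef) :
    ∃ b > 0, ∃ K : ℝ,
      (∀ x : ι → ℝ, ‖Complex.exp ((π : ℂ) * Complex.I *
        ∑ i, ∑ j, (x i : ℂ) * Ω i j * (x j : ℂ))‖ ≤ Real.exp (-b * ‖x‖ ^ 2)) ∧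
      ∀ x z : ι → ℝ, ‖z - x‖ ≤ 1 →
        ‖Complex.exp ((π : ℂ) * Complex.I * ∑ i, ∑ j, (z i : ℂ) * Ω i j * (z j : ℂ)) -
          Complex.exp ((π : ℂ) * Complex.I * ∑ i, ∑ j, (x i : ℂ) * Ω i j * (x j : ℂ))‖ ≤
        ‖z - x‖ * (K * Real.exp (-b * ‖x‖ ^ 2)) := by
  obtain ⟨c, hc, hle⟩ := hpos.exists_mul_sq_norm_le
  simp only [Matrix.of_apply] at hle
  set b : ℝ := π * c / 4 with hb
  have hbpos : 0 < b := by positivity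
  set A : ℝ := ∑ i, ∑ j, ‖Ω i j‖
  have hA0 : 0 ≤ A := by positivity
  have hre : ∀ x : ι → ℝ, ((π : ℂ) * Complex.I *
      ∑ i, ∑ j, (x i : ℂ) * Ω i j * (x j : ℂ)).re ≤ -(4 * b) * ‖x‖ ^ 2 := fun x => by
    rw [re_pi_mul_I_mul_quadratic, hb]
    nlinarith [mul_le_mul_of_nonneg_left (hle x) pi_pos.le]
  refine ⟨b, hbpos, Real.exp (4 * b) * (π * (A * (2 + 1 / b))), fun x => ?_, fun x z hzx => ?_⟩
  · rw [Complex.norm_exp]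
    refine Real.exp_le_exp.2 ((hre x).trans ?_)
    nlinarith [mul_nonneg hbpos.le (sq_nonneg ‖x‖)]
  set M : ℝ := 4 * b - 2 * b * ‖x‖ ^ 2 with hM
  have hxM := (hre x).trans (show _ ≤ M by nlinarith [mul_nonneg hbpos.le (sq_nonneg ‖x‖)])
  have hx_le : ‖x‖ ≤ ‖z‖ + ‖z - x‖ := norm_le_norm_add_norm_sub z x
  have hz_le : ‖z‖ ≤ ‖x‖ + ‖z - x‖ := norm_le_norm_add_norm_sub' z x
  have hsq : ‖x‖ ^ 2 ≤ 2 * ‖z‖ ^ 2 + 2 := by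
    have : ‖x‖ ^ 2 ≤ (‖z‖ + 1) ^ 2 := pow_le_pow_left₀ (norm_nonneg _) (by linarith) 2
    nlinarith [sq_nonneg (‖z‖ - 1)]
  have hzM := (hre z).trans (show _ ≤ M by
    nlinarith [mul_le_mul_of_nonneg_left hsq hbpos.le])
  refine (norm_cexp_sub_cexp_le hzM hxM).trans ?_
  rw [← mul_sub, norm_mul, norm_mul, Complex.norm_I, mul_one, Complex.norm_real,
    Real.norm_of_nonneg pi_pos.le]
  have hpoly : ‖z‖ + ‖x‖ ≤ (2 + 1 / b) * Real.exp (b * ‖x‖ ^ 2) := by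
    have h₁ : ‖z‖ + ‖x‖ ≤ 2 + ‖x‖ ^ 2 := by nlinarith [sq_nonneg (‖x‖ - 1)]
    have h₂ : 2 + ‖x‖ ^ 2 ≤ (2 + 1 / b) * (b * ‖x‖ ^ 2 + 1) := by
      have : (2 + 1 / b) * (b * ‖x‖ ^ 2 + 1) =
          2 + ‖x‖ ^ 2 + (2 * b * ‖x‖ ^ 2 + 1 / b) := by
        field_simp
        ring
      rw [this]
      have : 0 ≤ 2 * b * ‖x‖ ^ 2 + 1 / b := by positivity
      linarith
    exact h₁.trans (h₂.trans (mul_le_mul_of_nonneg_left (Real.add_one_le_exp _) (by positivity)))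
  have hexp : Real.exp M * Real.exp (b * ‖x‖ ^ 2) =
      Real.exp (4 * b) * Real.exp (-b * ‖x‖ ^ 2) := by
    rw [← Real.exp_add, ← Real.exp_add, hM]
    ring_nf
  calc Real.exp M * (π * ‖_‖)
      ≤ Real.exp M * (π * (A * (‖z - x‖ * ((2 + 1 / b) * Real.exp (b * ‖x‖ ^ 2))))) := by
        gcongr
        exact (norm_quadratic_sub_le Ω x z).trans (by gcongr)
    _ = ‖z - x‖ * (π * (A * (2 + 1 / b))) * (Real.exp M * Real.exp (b * ‖x‖ ^ 2)) := by ring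
    _ = _ := by rw [hexp]; ring

/-- If `f` varies by at most `h * g` at distance `h`, then the Riemann sum of `f` over the lattice
`h • ℤ^ι + w` approximates `∫ f` to within `h * ∫ g`, uniformly in `w`. -/
theorem norm_pow_smul_tsum_sub_integral_le {ι : Type*} [Fintype ι] {f : (ι → ℝ) → ℂ}
    {g : (ι → ℝ) → ℝ} (hfm : Measurable f) (hf : Integrable f) (hg : Integrable g)
    (hg0 : ∀ x, 0 ≤ g x) {h : ℝ} (hh : 0 < h)
    (hfg : ∀ x z, ‖z - x‖ ≤ h → ‖f z - f x‖ ≤ ‖z - x‖ * g x) (w : ι → ℝ) :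
    ‖h ^ Fintype.card ι • (∑' l : ι → ℤ, f (fun i => h * l i + w i)) - ∫ x, f x‖ ≤
      h * ∫ x, g x := by
  have hN : 0 < h ^ Fintype.card ι := pow_pos hh _
  have hscale : ∀ {E : Type} [NormedAddCommGroup E] [NormedSpace ℝ E] (φ : (ι → ℝ) → E),
      ∫ y, φ (h • y + w) = (h ^ Fintype.card ι)⁻¹ • ∫ x, φ x := fun φ => by
    rw [Measure.integral_comp_smul volume (fun x => φ (x + w)) h,
      integral_add_right_eq_self φ w, Module.finrank_fintype_fun_eq_card,
      abs_of_pos (inv_pos.2 hN)]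
  have hmain := norm_tsum_sub_integral_le_integral (F := fun y : ι → ℝ => f (h • y + w))
    (G := fun y => h * g (h • y + w))
    (hfm.comp (by fun_prop)) ((hf.comp_add_right w).comp_smul hh.ne')
    (((hg.comp_add_right w).comp_smul hh.ne').const_mul h) (fun y => by
      have hdist : ‖(h • (fun i => (⌊y i⌋ : ℝ)) + w) - (h • y + w)‖ ≤ h := by
        rw [add_sub_add_right_eq_sub, ← smul_sub, norm_smul, Real.norm_of_nonneg hh.le]
        refine mul_le_of_le_one_right hh.le ((pi_norm_le_iff_of_nonneg zero_le_one).2 fun i => ?_)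
        rw [Pi.sub_apply, Real.norm_eq_abs, abs_le]
        constructor <;> linarith [Int.floor_le (y i), Int.lt_floor_add_one (y i)]
      exact (hfg _ _ hdist).trans (mul_le_mul_of_nonneg_right hdist (hg0 _)))
  rw [integral_const_mul, hscale, hscale, smul_eq_mul] at hmain
  have hsplit : h ^ Fintype.card ι • (∑' l : ι → ℤ, f (fun i => h * l i + w i)) - ∫ x, f x =
      h ^ Fintype.card ι • ((∑' l : ι → ℤ, f (h • (fun i => (l i : ℝ)) + w)) -
        (h ^ Fintype.card ι)⁻¹ • ∫ x, f x) := by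
    rw [smul_sub, smul_inv_smul₀ hN.ne']
    rfl
  rw [hsplit, norm_smul, Real.norm_of_nonneg hN.le]
  refine (mul_le_mul_of_nonneg_left hmain hN.le).trans_eq ?_
  field_simp

/-- Gaussian-type Riemann sum estimate: for a symmetric complex `n×n` matrix `Ω` with
positive definite imaginary part, the Riemann sum
`k^{-n/2} Σ_{l ∈ (1/√k)ℤⁿ + w} exp(πi ᵗl Ω l)` converges to the Gaussian integral
`∫_{ℝⁿ} exp(πi ᵗl Ω l) dl` with error `O(1/√k)` uniformly in the shift `w ∈ ℝⁿ`. -/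
theorem gaussian_riemann_sum_estimate (n : ℕ) (Ω : Matrix (Fin n) (Fin n) ℂ)
    (hsym : Ω.IsSymm) (hpos : (Matrix.of fun i j => (Ω i j).im).PosDef) :
    ∃ C : ℝ, ∀ k : ℕ, 1 ≤ k → ∀ w : Fin n → ℝ,
      ‖((k : ℝ) ^ (-(n : ℝ) / 2) : ℝ) •
          (∑' l : Fin n → ℤ, Complex.exp ((π : ℂ) * Complex.I *
            ∑ i, ∑ j, (((l i : ℝ) / Real.sqrt k + w i : ℝ) : ℂ) * Ω i j *
              (((l j : ℝ) / Real.sqrt k + w j : ℝ) : ℂ)))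
        - ∫ x : Fin n → ℝ, Complex.exp ((π : ℂ) * Complex.I *
            ∑ i, ∑ j, (x i : ℂ) * Ω i j * (x j : ℂ))‖
        ≤ C / Real.sqrt k := by
  obtain ⟨b, hb, K, hdecay, hlip⟩ := exists_norm_gaussian_sub_le hpos
  have hexp := integrable_exp_neg_mul_sq_norm_pi (ι := Fin n) hb
  have hcont : Continuous fun x : Fin n → ℝ => Complex.exp ((π : ℂ) * Complex.I *
      ∑ i, ∑ j, (x i : ℂ) * Ω i j * (x j : ℂ)) := by fun_prop
  refine ⟨∫ x : Fin n → ℝ, |K| * Real.exp (-b * ‖x‖ ^ 2), fun k hk w => ?_⟩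
  have hk0 : (0 : ℝ) < k := by exact_mod_cast hk
  have hsqrt : 1 ≤ √(k : ℝ) := Real.one_le_sqrt.2 (by exact_mod_cast hk)
  have hest := norm_pow_smul_tsum_sub_integral_le hcont.measurable
    (hexp.mono' hcont.aestronglyMeasurable (ae_of_all _ hdecay)) (hexp.const_mul |K|)
    (fun x => by positivity) (h := (√(k : ℝ))⁻¹) (by positivity)
    (fun x z hzx => (hlip x z (hzx.trans (inv_le_one_of_one_le₀ hsqrt))).trans (by
      gcongr
      exact le_abs_self K)) w
  have hpow : (k : ℝ) ^ (-(n : ℝ) / 2) = (√(k : ℝ))⁻¹ ^ Fintype.card (Fin n) := by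
    rw [Fintype.card_fin, Real.sqrt_eq_rpow, ← Real.rpow_neg hk0.le, ← Real.rpow_natCast,
      ← Real.rpow_mul hk0.le]
    congr 1
    ring
  rw [hpow]
  simpa only [div_eq_inv_mul] using hest
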